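/- Let X ⊴ Y be finite groups with Y/X abelian, σ ∈ Gal(Q_{|Y|}/Q), and suppose the restriction map Irr(Y | 1_X) → Irr(Y' | 1_{X'}) induced by an inclusion Y' ≤ Y with Y'X = Y and Y' ∩ X = X' is bijective (since Y'/X' ≅ Y/X). For characters χ ∈ Irr(Y) restricting multiplicity-free to X and ψ ∈ Irr(Y') restricting multiplicity-free to X', with stabilizers satisfying Stab_{Irr(Y/X)}(χ) restricted to Y' equal to Stab_{Irr(Y'/X')}(ψ): then for constituents φ of χ|_X and ϑ of ψ|_{X'}, we have I_Y(φ) ∩ Y' = I_{Y'}(ϑ). -/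

import Mathlib

open scoped Classical BigOperators

/-- The inner product of two class functions on a finite group. -/
noncomputable def charInner {G : Type} [Group G] (φ ψ : G → ℂ) : ℂ :=
  (Nat.card G : ℂ)⁻¹ * ∑ᶠ g : G, φ g * ψ g⁻¹

/-- `χ : G → ℂ` is an irreducible (complex) character of `G`. -/
def IsIrredChar (G : Type) [Group G] (χ : G → ℂ) : Prop :=
  ∃ V : FDRep ℂ G, CategoryTheory.Simple V ∧ χ = V.character

open CategoryTheory in
theorem FDRep.isIrreducible_of_simple {k G : Type} [Field k] [Group G] (V : FDRep k G)
    [Simple V] : Representation.IsIrreducible V.ρ := by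
  have hnt : Nontrivial V := by
    by_contra h
    rw [not_nontrivial_iff_subsingleton] at h
    apply id_nonzero V
    apply Action.hom_ext
    ext v
    exact Subsingleton.elim _ _
  have : Nontrivial (Subrepresentation V.ρ) := by
    refine ⟨⊥, ⊤, fun h => ?_⟩
    obtain ⟨v, hv⟩ := exists_ne (0 : V)
    have hm : v ∈ (⊤ : Subrepresentation V.ρ).toSubmodule := Submodule.mem_top
    rw [← h] at hm
    exact hv ((Submodule.mem_bot k).mp hm)
  refine ⟨fun S => ?_⟩
  let j : FDRep.of S.toRepresentation ⟶ V :=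
    ⟨InducedCategory.homMk (ModuleCat.ofHom S.toSubmodule.subtype), fun g => by ext; rfl⟩
  have hj : ∀ v : S.toSubmodule, j v = (v : V) := fun _ => rfl
  have hjm : Mono j := ConcreteCategory.mono_of_injective j Subtype.val_injective
  by_cases h0 : j = 0
  · left
    ext v
    constructor
    · intro hv
      have : j ⟨v, hv⟩ = 0 := by rw [h0]; rfl
      exact (Submodule.mem_bot k).2 this
    · intro hv
      rw [(Submodule.mem_bot k).1 hv]
      exact S.toSubmodule.zero_mem
  · right
    have := (Simple.mono_isIso_iff_nonzero j).2 h0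
    have hs := (ConcreteCategory.bijective_of_isIso j).2
    ext v
    obtain ⟨w, rfl⟩ := hs v
    exact ⟨fun _ => Submodule.mem_top, fun _ => w.2⟩

namespace Representation
variable {G : Type} [Group G] {V : Type} [AddCommGroup V] [Module ℂ V]

theorem isIrreducible_of_sum_char [FiniteDimensional ℂ V] [Fintype G] (ρ : Representation ℂ G V)
    (h : ∑ g : G, ρ.character g * ρ.character g⁻¹ = Nat.card G) : IsIrreducible ρ := by
  have : CategoryTheory.Simple (FDRep.of ρ) := (FDRep.simple_iff_char_is_norm_one _).2 h
  exact FDRep.isIrreducible_of_simple (FDRep.of ρ)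

theorem sum_char_of_isIrreducible [FiniteDimensional ℂ V] [Fintype G] (ρ : Representation ℂ G V)
    [IsIrreducible ρ] : ∑ g : G, ρ.character g * ρ.character g⁻¹ = Nat.card G := by
  have : Invertible (Nat.card G : ℂ) := invertibleOfNonzero (by simp)
  have h := char_orthonormal ρ ρ
  rw [if_pos ⟨Equiv.refl ρ⟩, inv_mul_eq_one₀ (by simp)] at h
  exact h.symm

theorem nonempty_equiv_of_sum_ne_zero {W : Type} [AddCommGroup W] [Module ℂ W]
    [FiniteDimensional ℂ V] [FiniteDimensional ℂ W] [Fintype G] (ρ : Representation ℂ G V)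
    (σ : Representation ℂ G W) [IsIrreducible ρ] [IsIrreducible σ]
    (h : ∑ g : G, ρ.character g * σ.character g⁻¹ ≠ 0) : Nonempty (Equiv σ ρ) := by
  have : Invertible (Nat.card G : ℂ) := invertibleOfNonzero (by simp)
  by_contra hne
  have h' := char_orthonormal ρ σ
  rw [if_neg hne] at h'
  simp_all

theorem nontrivial_of_isIrreducible (ρ : Representation ℂ G V) [IsIrreducible ρ] :
    Nontrivial V := by
  by_contra h
  rw [not_nontrivial_iff_subsingleton] at h
  obtain ⟨S, T, hST⟩ := exists_pair_ne (Subrepresentation ρ)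
  apply hST
  ext v
  rw [Subsingleton.elim v 0]
  exact ⟨fun _ => T.toSubmodule.zero_mem, fun _ => S.toSubmodule.zero_mem⟩

/-- The twist of a representation by a linear character. -/
def twist (ρ : Representation ℂ G V) (μ : G →* ℂ) : Representation ℂ G V where
  toFun g := μ g • ρ g
  map_one' := by simp
  map_mul' a b := by rw [map_mul, map_mul, smul_mul_smul_comm]

theorem char_twist (ρ : Representation ℂ G V) (μ : G →* ℂ) (g : G) :
    (ρ.twist μ).character g = μ g * ρ.character g := by
  simp [character, twist]

theorem isIrreducible_twist [FiniteDimensional ℂ V] [Finite G] (ρ : Representation ℂ G V)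
    [IsIrreducible ρ] (μ : G →* ℂ) : IsIrreducible (ρ.twist μ) := by
  have := Fintype.ofFinite G
  apply isIrreducible_of_sum_char
  rw [← sum_char_of_isIrreducible ρ]
  refine Finset.sum_congr rfl fun g _ => ?_
  have : μ g * μ g⁻¹ = 1 := by rw [← map_mul]; simp
  rw [char_twist, char_twist]
  linear_combination (ρ.character g * ρ.character g⁻¹) * this

theorem isIrreducible_comp_mulEquiv [FiniteDimensional ℂ V] [Finite G] (ρ : Representation ℂ G V)
    [IsIrreducible ρ] (c : G ≃* G) :
    IsIrreducible (MonoidHom.comp ρ c.toMonoidHom : Representation ℂ G V) := by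
  have := Fintype.ofFinite G
  apply isIrreducible_of_sum_char
  rw [← sum_char_of_isIrreducible ρ, ← c.toEquiv.sum_comp fun g => ρ.character g * ρ.character g⁻¹]
  simp [character]

/-- A nonzero intertwiner from an irreducible representation to a twist of it is the same as
equality of the two characters. -/
theorem mul_char_eq_char_iff [FiniteDimensional ℂ V] [Finite G] (ρ : Representation ℂ G V)
    [IsIrreducible ρ] (μ : G →* ℂ) :
    (∀ g, μ g * ρ.character g = ρ.character g) ↔
      ∃ A : Module.End ℂ V, A ≠ 0 ∧ ∀ g, A * ρ g = μ g • (ρ g * A) := by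
  have := Fintype.ofFinite G
  have := isIrreducible_twist ρ μ
  constructor
  · intro h
    have hchar : (ρ.twist μ).character = ρ.character := funext fun g => by rw [char_twist, h]
    obtain ⟨e⟩ := nonempty_equiv_of_sum_ne_zero (ρ.twist μ) ρ (by
      rw [hchar, sum_char_of_isIrreducible]; simp)
    refine ⟨e.toIntertwiningMap.toLinearMap, fun h0 => ?_, e.toIntertwiningMap.isIntertwining'⟩
    have h1 : e.toIntertwiningMap = 0 := IntertwiningMap.ext h0
    have : Nontrivial V := nontrivial_of_isIrreducible ρ
    obtain ⟨v, hv⟩ := exists_ne (0 : V)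
    apply hv
    apply e.injective
    exact (DFunLike.congr_fun h1 v).trans (DFunLike.congr_fun h1 0).symm
  · rintro ⟨A, h0, hA⟩ g
    let f : IntertwiningMap ρ (ρ.twist μ) := ⟨A, hA⟩
    have hf := (IsIrreducible.bijective_or_eq_zero f).resolve_right
      fun h => h0 (congrArg IntertwiningMap.toLinearMap h)
    rw [← char_twist, char_iso (f.ofBijective hf)]

theorem eq_smul_one [FiniteDimensional ℂ V] (ρ : Representation ℂ G V) [IsIrreducible ρ]
   (A : Module.End ℂ V) (hA : ∀ g, A * ρ g = ρ g * A) : ∃ s : ℂ, A = s • 1 := by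
  obtain ⟨s, hs⟩ := IsIrreducible.algebraMap_intertwiningMap_bijective_of_isAlgClosed.2
    (⟨A, hA⟩ : IntertwiningMap ρ ρ)
  refine ⟨s, ?_⟩
  have := congrArg IntertwiningMap.toLinearMap hs
  exact this.symm

/-- If every linear character `μ` of the abelian quotient `Q` fixing the character of `ρ` is
trivial at `q g`, then `ρ g` commutes with every operator commuting with the kernel of `q`. -/
theorem commute_of_forall_linearChar [FiniteDimensional ℂ V] [Finite G]
    {Q : Type} [CommGroup Q] [Finite Q] (ρ : Representation ℂ G V) [IsIrreducible ρ] (q : G →* Q)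
    (P : Module.End ℂ V) (hP : ∀ h, q h = 1 → Commute (ρ h) P) (g : G)
    (hg : ∀ μ : Q →* ℂ, (∀ h, μ (q h) * ρ.character h = ρ.character h) → μ (q g) = 1) :
    Commute (ρ g) P := by
  classical
  have := Fintype.ofFinite G
  have := Fintype.ofFinite Q
  let A (μ : Q →* ℂ) : Module.End ℂ V := ∑ h : G, μ (q h) • (ρ h * P * ρ h⁻¹)
  have hA (μ : Q →* ℂ) (k : G) : A μ * ρ k = (μ.comp q) k • (ρ k * A μ) := by
    simp only [A]
    rw [Finset.sum_mul, Finset.mul_sum, Finset.smul_sum,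
      ← Equiv.sum_comp (Equiv.mulLeft k) fun h => μ (q h) • (ρ h * P * ρ h⁻¹) * ρ k]
    refine Finset.sum_congr rfl fun h _ => ?_
    have hk : ρ k⁻¹ * ρ k = 1 := by rw [← map_mul]; simp
    simp only [Equiv.coe_mulLeft, map_mul, mul_inv_rev, MonoidHom.comp_apply, smul_mul_assoc,
      mul_smul_comm, smul_smul, mul_assoc, hk, mul_one]
  have hcomm (μ : Q →* ℂ) : Commute (ρ g) (A μ) := by
    by_cases h0 : A μ = 0
    · rw [h0]; exact Commute.zero_right _
    · have := hg μ ((mul_char_eq_char_iff ρ (μ.comp q)).2 ⟨A μ, h0, hA μ⟩)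
      have h := hA μ g
      rw [MonoidHom.comp_apply, this, one_smul] at h
      exact h.symm
  let toHom (ψ : AddChar (Additive Q) ℂ) : Q →* ℂ :=
    { toFun x := ψ (Additive.ofMul x)
      map_one' := ψ.map_zero_eq_one
      map_mul' a b := ψ.map_add_eq_mul _ _ }
  have hsum : ∑ ψ : AddChar (Additive Q) ℂ, A (toHom ψ) =
      (Fintype.card (Additive Q) * ∑ h : G, if q h = 1 then (1 : ℂ) else 0) • P := by
    simp only [A]
    rw [Finset.sum_comm, Finset.mul_sum, Finset.sum_smul]
    refine Finset.sum_congr rfl fun h _ => ?_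
    have hs : ∑ ψ : AddChar (Additive Q) ℂ, toHom ψ (q h) = _ :=
      AddChar.sum_apply_eq_ite (Additive.ofMul (q h))
    rw [← Finset.sum_smul, hs]
    by_cases h1 : q h = 1
    · have hh : ρ h * ρ h⁻¹ = 1 := by rw [← map_mul]; simp
      rw [(hP h h1).eq, mul_assoc, hh]
      simp [h1]
    · simp [h1]
  have hne : (Fintype.card (Additive Q) * ∑ h : G, if q h = 1 then (1 : ℂ) else 0) ≠ 0 := by
    refine mul_ne_zero (by simp) ?_
    rw [Finset.sum_boole]
    simp only [ne_eq, Nat.cast_eq_zero, Finset.card_eq_zero]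
    exact Finset.ne_empty_of_mem (a := 1) (by simp)
  have hc : Commute (ρ g) (∑ ψ : AddChar (Additive Q) ℂ, A (toHom ψ)) :=
    Commute.sum_right _ _ _ fun ψ _ => hcomm _
  rw [hsum] at hc
  exact (Commute.smul_right_iff₀ hne).1 hc

/-- A class function acts on an irreducible representation by a scalar. -/
theorem exists_sum_smul_eq_smul_one [FiniteDimensional ℂ V] [Fintype G] (τ : Representation ℂ G V)
    [IsIrreducible τ] (α : G → ℂ) (hα : ∀ g h, α (h * g * h⁻¹) = α g) :
    ∃ s : ℂ, ∑ n, α n⁻¹ • τ n = s • 1 ∧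
      s * Module.finrank ℂ V = ∑ n, τ.character n * α n⁻¹ := by
  obtain ⟨s, hs⟩ := eq_smul_one τ (∑ n, α n⁻¹ • τ n) fun m => by
    rw [Finset.sum_mul, Finset.mul_sum,
      ← (MulAut.conj m).toEquiv.sum_comp fun n => α n⁻¹ • τ n * τ m]
    refine Finset.sum_congr rfl fun n _ => ?_
    have h1 : α (m * n * m⁻¹)⁻¹ = α n⁻¹ := by rw [← hα n⁻¹ m]; group
    simp only [MulEquiv.toEquiv_eq_coe, EquivLike.coe_coe, MulAut.conj_apply, h1, smul_mul_assoc,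
      mul_smul_comm, ← map_mul, inv_mul_cancel_right]
  refine ⟨s, hs, ?_⟩
  have := congrArg (LinearMap.trace ℂ V) hs
  simp only [map_sum, map_smul, LinearMap.trace_one, smul_eq_mul] at this
  rw [← this]
  exact Finset.sum_congr rfl fun n _ => mul_comm _ _

/-- The inertia group of a constituent `τ` of multiplicity one in the restriction of `ρ` to the
kernel of `q` is cut out by the linear characters of `Q` fixing the character of `ρ`. -/
theorem char_conj_eq_iff_forall_linearChar [FiniteDimensional ℂ V] [Finite G]
    {N Q W : Type} [Group N] [Finite N] [CommGroup Q] [Finite Q]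
    [AddCommGroup W] [Module ℂ W] [FiniteDimensional ℂ W]
    (i : N →* G) (q : G →* Q) (hiq : q.ker = i.range)
    (ρ : Representation ℂ G V) [IsIrreducible ρ] (τ : Representation ℂ N W) [IsIrreducible τ]
    (hmult : Module.finrank ℂ (IntertwiningMap τ (MonoidHom.comp ρ i : Representation ℂ N V)) = 1)
    (g : G) (c : N ≃* N) (hc : ∀ n, i (c n) = g * i n * g⁻¹) :
    (∀ n, τ.character (c n) = τ.character n) ↔
      ∀ μ : Q →* ℂ, (∀ h, μ (q h) * ρ.character h = ρ.character h) → μ (q g) = 1 := by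
  have := Fintype.ofFinite G
  have := Fintype.ofFinite N
  have hqi (n : N) : q (i n) = 1 := by
    have : i n ∈ q.ker := hiq ▸ ⟨n, rfl⟩
    exact this
  obtain ⟨f, hf0, hf⟩ := finrank_eq_one_iff'.1 hmult
  have hfi (n : N) (w : W) : f (τ n w) = ρ (i n) (f w) := IntertwiningMap.isIntertwining _ _ f n w
  obtain ⟨w₀, hw₀⟩ : ∃ w, f w ≠ 0 := by
    by_contra! h
    exact hf0 (DFunLike.ext _ _ h)
  constructor
  · intro h μ hμ
    obtain ⟨A, hA0, hA⟩ := (mul_char_eq_char_iff ρ (μ.comp q)).1 hμ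
    have hA' (k : G) (v : V) : A (ρ k v) = μ (q k) • ρ k (A v) := LinearMap.congr_fun (hA k) v
    have hAinj : Function.Injective A :=
      (IsIrreducible.injective_or_eq_zero
        (⟨A, hA⟩ : IntertwiningMap ρ (ρ.twist (μ.comp q)))).resolve_right
        fun h => hA0 (congrArg IntertwiningMap.toLinearMap h)
    have := isIrreducible_comp_mulEquiv τ c
    let τc : Representation ℂ N W := MonoidHom.comp τ c.toMonoidHom
    obtain ⟨T⟩ := nonempty_equiv_of_sum_ne_zero τc τ (by
      have hchar : τc.character = τ.character := funext h
      rw [hchar, sum_char_of_isIrreducible]; simp)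
    have hT (n : N) (w : W) : T (τ n w) = τ (c n) (T w) :=
      IntertwiningMap.isIntertwining _ _ T.toIntertwiningMap n w
    obtain ⟨a, ha⟩ := hf (LinearMap.intertwiningMap_of_isIntertwiningMap _ _
      (A ∘ₗ f.toLinearMap) fun n w => by
        simp [hfi, hA', hqi])
    obtain ⟨b, hb⟩ := hf (LinearMap.intertwiningMap_of_isIntertwiningMap _ _
      (ρ g⁻¹ ∘ₗ f.toLinearMap ∘ₗ T.toIntertwiningMap.toLinearMap) fun n w => by
        change ρ g⁻¹ (f (T (τ n w))) = ρ (i n) (ρ g⁻¹ (f (T w)))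
        rw [hT, hfi, hc]
        simp only [← Module.End.mul_apply, ← map_mul]
        group)
    have ha' (w : W) : a • f w = A (f w) := DFunLike.congr_fun ha w
    have hb' (w : W) : b • f w = ρ g⁻¹ (f (T w)) := DFunLike.congr_fun hb w
    have hb'' (w : W) : f (T w) = b • ρ g (f w) := by
      rw [← map_smul, hb', ← Module.End.mul_apply, ← map_mul]; simp
    have ha0 : a ≠ 0 := by
      rintro rfl
      apply hw₀
      apply hAinj
      rw [← ha']; simp
    have hb0 : b ≠ 0 := by
      rintro rfl
      obtain ⟨w₁, hw₁⟩ := T.surjective w₀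
      apply hw₀
      have h1 := hb'' w₁
      rwa [zero_smul, show T w₁ = w₀ from hw₁] at h1
    have key : (a * b) • ρ g (f w₀) = (a * b * μ (q g)) • ρ g (f w₀) := by
      have h1 := ha' (T w₀)
      rw [hb'', map_smul, hA', ← ha', map_smul, smul_smul, smul_smul, smul_smul] at h1
      rw [h1]; congr 1; ring
    have hne : ρ g (f w₀) ≠ 0 := by
      intro h0
      apply hw₀
      have := congrArg (ρ g⁻¹) h0
      rwa [← Module.End.mul_apply, ← map_mul, inv_mul_cancel, map_one, map_zero] at this
    have := smul_left_injective ℂ hne key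
    field_simp at this
    exact this.symm
  · intro hg
    let σ : Representation ℂ N W := MonoidHom.comp τ c.symm.toMonoidHom
    have : IsIrreducible σ := isIrreducible_comp_mulEquiv τ c.symm
    have hσ (n : N) : σ.character n = τ.character (c.symm n) := rfl
    let P (α : N → ℂ) : Module.End ℂ V := ∑ n, α n⁻¹ • ρ (i n)
    have hPcomm : Commute (ρ g) (P τ.character) := by
      refine commute_of_forall_linearChar ρ q _ (fun h hh => ?_) g hg
      obtain ⟨m, rfl⟩ : h ∈ i.range := hiq ▸ hh
      symm
      simp only [P, Commute, SemiconjBy]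
      rw [Finset.sum_mul, Finset.mul_sum,
        ← (MulAut.conj m).toEquiv.sum_comp fun n => τ.character n⁻¹ • ρ (i n) * ρ (i m)]
      refine Finset.sum_congr rfl fun n _ => ?_
      have h1 : τ.character (m * n * m⁻¹)⁻¹ = τ.character n⁻¹ := by
        rw [← char_conj τ n⁻¹ m]; group
      simp only [MulEquiv.toEquiv_eq_coe, EquivLike.coe_coe, MulAut.conj_apply, h1, smul_mul_assoc,
        mul_smul_comm, ← map_mul, inv_mul_cancel_right]
    have hPσ : ρ g * P τ.character = P σ.character * ρ g := by
      simp only [P]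
      rw [← c.toEquiv.sum_comp fun n => σ.character n⁻¹ • ρ (i n), Finset.sum_mul, Finset.mul_sum]
      refine Finset.sum_congr rfl fun n _ => ?_
      simp [hσ, hc, ← map_mul]
    have hP : P τ.character = P σ.character := by
      have h1 := hPcomm.eq.symm.trans hPσ
      have h2 : ρ g * ρ g⁻¹ = 1 := by rw [← map_mul]; simp
      simpa [mul_assoc, h2] using congrArg (· * ρ g⁻¹) h1
    have hPf (α : N → ℂ) (w : W) : P α (f w) = f ((∑ n, α n⁻¹ • τ n) w) := by
      simp [P, LinearMap.sum_apply, hfi]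
    obtain ⟨s, hs, hs'⟩ := exists_sum_smul_eq_smul_one τ τ.character (char_conj τ)
    obtain ⟨t, ht, ht'⟩ := exists_sum_smul_eq_smul_one τ σ.character (char_conj σ)
    have hst : s = t := by
      have h1 := hPf τ.character w₀
      rw [hP, hPf, hs, ht] at h1
      simp only [LinearMap.smul_apply, Module.End.one_apply, map_smul] at h1
      exact (smul_left_injective ℂ hw₀ h1).symm
    obtain ⟨e⟩ := nonempty_equiv_of_sum_ne_zero τ σ (by
      rw [← ht', ← hst, hs', sum_char_of_isIrreducible]; simp)
    intro n
    have h1 := congrFun (char_iso e) (c n)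
    rw [hσ, c.symm_apply_apply] at h1
    exact h1.symm

theorem charInner_eq_finrank [FiniteDimensional ℂ V] [Finite G] {W : Type} [AddCommGroup W]
    [Module ℂ W] [FiniteDimensional ℂ W] (τ : Representation ℂ G W) (ρ : Representation ℂ G V) :
    charInner ρ.character τ.character = Module.finrank ℂ (IntertwiningMap τ ρ) := by
  have := Fintype.ofFinite G
  have : Invertible (Nat.card G : ℂ) := invertibleOfNonzero (by simp)
  rw [← card_inv_mul_sum_char_mul_char_eq_finrank, charInner, finsum_eq_sum_of_fintype]

end Representation

open Representation in
/-- A conjugation fixes a constituent `φ` of multiplicity one exactly when it lies in the kernel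
of every linear character of the abelian quotient fixing `χ`. -/
theorem IsIrredChar.conj_eq_iff_forall_linearChar {G N Q : Type} [Group G] [Finite G] [Group N]
    [CommGroup Q] [Finite Q] (i : N →* G) (hi : Function.Injective i) (q : G →* Q)
    (hiq : q.ker = i.range) {χ : G → ℂ} (hχ : IsIrredChar G χ) {φ : N → ℂ}
    (hφ : IsIrredChar N φ) (hmult : charInner (fun n => χ (i n)) φ = 1)
    (g : G) (c : N → N) (hc : ∀ n, i (c n) = g * i n * g⁻¹) :
    (∀ n, φ (c n) = φ n) ↔
      ∀ μ : Q →* ℂ, (∀ h, μ (q h) * χ h = χ h) → μ (q g) = 1 := by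
  have : Finite N := Finite.of_injective i hi
  obtain ⟨V, hV, rfl⟩ := hχ
  obtain ⟨W, hW, rfl⟩ := hφ
  have := V.isIrreducible_of_simple
  have := W.isIrreducible_of_simple
  let c' : N →* N := MonoidHom.mk' c fun a b => hi (by simp [hc])
  have hc' : Function.Injective c' := fun a b h => hi (by
    have h1 : i (c a) = i (c b) := congrArg i h
    simpa [hc] using h1)
  refine char_conj_eq_iff_forall_linearChar i q hiq V.ρ W.ρ ?_ g
    (MulEquiv.ofBijective c' (Finite.injective_iff_bijective.1 hc')) hc
  have h1 := charInner_eq_finrank W.ρ (MonoidHom.comp V.ρ i : Representation ℂ N V)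
  exact_mod_cast h1.symm.trans hmult

/-- Let `X ⊴ Y` with `Y/X` abelian, `Y' ≤ Y` with `Y'X = Y` and `X' = X ⊓ Y'`. Suppose
`χ ∈ Irr(Y)` and `ψ ∈ Irr(Y')` restrict multiplicity-free to `X` resp. `X'`, and the
stabilizer of `χ` in `Irr(Y/X)` corresponds under restriction to the stabilizer of `ψ`
in `Irr(Y'/X')`. Then for constituents `φ` of `χ|_X` and `ϑ` of `ψ|_{X'}` we have
`I_Y(φ) ∩ Y' = I_{Y'}(ϑ)`. -/
theorem stmt_13 {Y : Type} [Group Y] [Fintype Y] (X Y' : Subgroup Y) [hX : X.Normal]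
    (hab : ∀ a b : Y ⧸ X, a * b = b * a)
    (hgen : ∀ y : Y, ∃ y' ∈ Y', ∃ x ∈ X, y = y' * x)
    (σ : ℂ →+* ℂ)
    (χ : Y → ℂ) (hχ : IsIrredChar Y χ)
    (hmfχ : ∀ ρ : ↥X → ℂ, IsIrredChar ↥X ρ →
      charInner (fun x : ↥X => χ ↑x) ρ = 0 ∨ charInner (fun x : ↥X => χ ↑x) ρ = 1)
    (ψ : ↥Y' → ℂ) (hψ : IsIrredChar ↥Y' ψ)
    (hmfψ : ∀ ρ : ↥(X ⊓ Y') → ℂ, IsIrredChar ↥(X ⊓ Y') ρ →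
      charInner (fun x : ↥(X ⊓ Y') => ψ (Subgroup.inclusion inf_le_right x)) ρ = 0 ∨
        charInner (fun x : ↥(X ⊓ Y') => ψ (Subgroup.inclusion inf_le_right x)) ρ = 1)
    (hstab : ∀ lam : Y →* ℂ, (∀ x ∈ X, lam x = 1) →
      ((∀ y : Y, lam y * χ y = χ y) ↔ (∀ y' : ↥Y', lam ↑y' * ψ y' = ψ y')))
    (φ : ↥X → ℂ) (hφ : IsIrredChar ↥X φ)
    (hφc : charInner (fun x : ↥X => χ ↑x) φ ≠ 0)
    (ϑ : ↥(X ⊓ Y') → ℂ) (hϑ : IsIrredChar ↥(X ⊓ Y') ϑ)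
    (hϑc : charInner (fun x : ↥(X ⊓ Y') => ψ (Subgroup.inclusion inf_le_right x)) ϑ ≠ 0) :
    ∀ y' : ↥Y',
      (∀ x : ↥X, φ ⟨↑y' * ↑x * (↑y' : Y)⁻¹, hX.conj_mem ↑x x.2 ↑y'⟩ = φ x) ↔
      (∀ x : ↥(X ⊓ Y'), ϑ ⟨↑y' * ↑x * (↑y' : Y)⁻¹,
          Subgroup.mem_inf.mpr ⟨hX.conj_mem ↑x (Subgroup.mem_inf.mp x.2).1 ↑y',
            mul_mem (mul_mem y'.2 (Subgroup.mem_inf.mp x.2).2) (inv_mem y'.2)⟩⟩ = ϑ x) := by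
  intro y'
  let : CommGroup (Y ⧸ X) := { (inferInstance : Group (Y ⧸ X)) with mul_comm := hab }
  let q : Y →* Y ⧸ X := QuotientGroup.mk' X
  have hq : q.ker = X.subtype.range := by
    rw [QuotientGroup.ker_mk', Subgroup.range_subtype]
  have hq' : (q.comp Y'.subtype).ker =
      (Subgroup.inclusion (inf_le_right : X ⊓ Y' ≤ Y')).range := by
    ext y
    rw [Subgroup.inclusion_range]
    simp [q, MonoidHom.mem_ker, Subgroup.mem_subgroupOf, QuotientGroup.eq_one_iff]
  rw [hχ.conj_eq_iff_forall_linearChar X.subtype X.subtype_injective q hq hφ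
      ((hmfχ φ hφ).resolve_left hφc) y' _ fun _ => rfl,
    hψ.conj_eq_iff_forall_linearChar (Subgroup.inclusion inf_le_right)
      (Subgroup.inclusion_injective _) (q.comp Y'.subtype) hq' hϑ
      ((hmfψ ϑ hϑ).resolve_left hϑc) y' _ fun _ => rfl]
  refine forall_congr' fun μ => imp_congr (hstab (μ.comp q) fun x hx => ?_) Iff.rfl
  rw [MonoidHom.comp_apply, show q x = 1 from (QuotientGroup.eq_one_iff x).2 hx, map_one]
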